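/- Let N be a dyadic number and w ∈ C¹(𝕋). Then the commutator [∂_x P_N², w], acting on v by [∂_x P_N², w]v = ∂_x P_N²(w v) − w ∂_x P_N² v, satisfies ‖[∂_x P_N², w] v‖_{L²(𝕋)} ≤ C ‖∂_x w‖_{L^∞} ‖v‖_{L²(𝕋)} with C independent of N. -/

import Mathlib

open Real MeasureTheory intervalIntegral
noncomputable section

/-- `k`-th Fourier coefficient of a `2π`-periodic function on `ℝ`. -/
def fc (u : ℝ → ℂ) (k : ℤ) : ℂ :=
  (1 / (2 * π)) * ∫ t in (0 : ℝ)..(2 * π), u t * Complex.exp (-Complex.I * k * t)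

/-- The operator `∂ₓ P_N²` associated with a frequency multiplier `m : ℤ → ℝ`. -/
def dPNsq (m : ℤ → ℝ) (u : ℝ → ℂ) : ℝ → ℂ := fun x =>
  ∑' k : ℤ, Complex.I * (k : ℂ) * ((m k : ℝ) : ℂ) ^ 2 * fc u k *
    Complex.exp (Complex.I * (k : ℂ) * (x : ℂ))


/-- forward difference of a real function -/
def fdiff (h : ℝ) (g : ℝ → ℝ) : ℝ → ℝ := fun x => g (x + h) - g x

/-- forward difference of a sequence -/
def sdiff' (a : ℤ → ℝ) : ℤ → ℝ := fun k => a (k + 1) - a k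

/-- kernel with coefficients `a` -/
def Kr (a : ℤ → ℝ) (y : ℝ) : ℂ := ∑' k : ℤ, (a k : ℂ) * Complex.exp (Complex.I * k * y)

lemma fdiff_bound (g : ℝ → ℝ) (hg : Differentiable ℝ g) (B h : ℝ) (hh : 0 ≤ h)
    (hB : ∀ x, |deriv g x| ≤ B) (x : ℝ) : |fdiff h g x| ≤ B * h := by
  have := Convex.norm_image_sub_le_of_norm_deriv_le (f := g) (s := Set.univ) (C := B)
    (x := x) (y := x + h) (fun x _ => hg x) (fun x _ => hB x) convex_univ trivial trivial
  simpa [fdiff, abs_of_nonneg hh] using this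

lemma fdiff_contDiff (g : ℝ → ℝ) (hg : ContDiff ℝ (⊤ : ℕ∞) g) (h : ℝ) :
    ContDiff ℝ (⊤ : ℕ∞) (fdiff h g) := by
  unfold fdiff; fun_prop

lemma deriv_fdiff (g : ℝ → ℝ) (hg : Differentiable ℝ g) (h : ℝ) :
    deriv (fdiff h g) = fdiff h (deriv g) := by
  ext x
  unfold fdiff
  rw [deriv_fun_sub (by fun_prop) (by fun_prop), deriv_comp_add_const]

lemma contDiff_deriv_top (g : ℝ → ℝ) (hg : ContDiff ℝ (⊤ : ℕ∞) g) :
    ContDiff ℝ (⊤ : ℕ∞) (deriv g) := by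
  have := (contDiff_infty_iff_deriv (f := g) (𝕜 := ℝ)).1 hg
  exact this.2

lemma fdiff3_bound (g : ℝ → ℝ) (hg : ContDiff ℝ (⊤ : ℕ∞) g) (B h : ℝ) (hh : 0 ≤ h)
    (hB : ∀ x, |deriv (deriv (deriv g)) x| ≤ B) (x : ℝ) :
    |fdiff h (fdiff h (fdiff h g)) x| ≤ B * h * h * h := by
  have df : ∀ f : ℝ → ℝ, ContDiff ℝ (⊤ : ℕ∞) f → Differentiable ℝ f :=
    fun f hf => hf.differentiable (by simp)
  have h1 := contDiff_deriv_top g hg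
  have h2 := contDiff_deriv_top _ h1
  refine fdiff_bound _ (df _ (fdiff_contDiff _ (fdiff_contDiff _ hg h) h)) _ _ hh ?_ x
  intro x
  rw [deriv_fdiff _ (df _ (fdiff_contDiff _ hg h)), deriv_fdiff _ (df _ hg)]
  refine fdiff_bound _ (df _ (fdiff_contDiff _ h1 h)) _ _ hh ?_ x
  intro x
  rw [deriv_fdiff _ (df _ h1)]
  exact fdiff_bound _ (df _ h2) _ _ hh hB x

lemma bdd_of_compact (g : ℝ → ℝ) (hg : Continuous g) (hs : HasCompactSupport g) :
    ∃ B, 0 ≤ B ∧ ∀ x, |g x| ≤ B := by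
  obtain ⟨B, hB⟩ := hs.exists_bound_of_continuous hg
  exact ⟨B, (norm_nonneg _).trans (hB 0), hB⟩

lemma Kr_eq_sum (a : ℤ → ℝ) (R : ℕ) (ha : ∀ k : ℤ, (R : ℤ) < |k| → a k = 0) (y : ℝ) :
    Kr a y = ∑ k ∈ Finset.Icc (-(R : ℤ)) R, (a k : ℂ) * Complex.exp (Complex.I * k * y) := by
  unfold Kr
  apply tsum_eq_sum
  intro k hk
  rw [ha k]
  · simp
  · by_contra! h
    exact hk (Finset.mem_Icc.2 (abs_le.1 h))

lemma Kr_summable (a : ℤ → ℝ) (R : ℕ) (ha : ∀ k : ℤ, (R : ℤ) < |k| → a k = 0) (y : ℝ) :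
    Summable fun k : ℤ => (a k : ℂ) * Complex.exp (Complex.I * k * y) := by
  apply summable_of_ne_finset_zero (s := Finset.Icc (-(R : ℤ)) R)
  intro k hk
  rw [ha k]
  · simp
  · by_contra! h
    exact hk (Finset.mem_Icc.2 (abs_le.1 h))

lemma norm_exp_one (k : ℤ) (y : ℝ) : ‖Complex.exp (Complex.I * k * y)‖ = 1 := by
  have : Complex.I * k * y = ((k * y : ℝ) : ℂ) * Complex.I := by push_cast; ring
  rw [this, Complex.norm_exp_ofReal_mul_I]

lemma Kr_bound (a : ℤ → ℝ) (R : ℕ) (ha : ∀ k : ℤ, (R : ℤ) < |k| → a k = 0) (B : ℝ)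
    (hB : ∀ k, |a k| ≤ B) (y : ℝ) : ‖Kr a y‖ ≤ (2 * R + 1) * B := by
  rw [Kr_eq_sum a R ha]
  refine (norm_sum_le _ _).trans ?_
  refine (Finset.sum_le_card_nsmul _ _ B ?_).trans ?_
  · intro k _
    rw [norm_mul, norm_exp_one, mul_one, Complex.norm_real]
    exact hB k
  · rw [nsmul_eq_mul, Int.card_Icc]
    have : ((R : ℤ) + 1 - -(R : ℤ)).toNat = 2 * R + 1 := by omega
    rw [this]; push_cast; rfl

lemma Kr_sdiff (a : ℤ → ℝ) (R : ℕ) (ha : ∀ k : ℤ, (R : ℤ) < |k| → a k = 0) (y : ℝ) :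
    Kr (sdiff' a) y = (Complex.exp (-Complex.I * y) - 1) * Kr a y := by
  have hs := Kr_summable a R ha y
  have e1 : ∀ k : ℤ, (a (k + 1) : ℂ) * Complex.exp (Complex.I * k * y)
      = Complex.exp (-Complex.I * y) *
        ((a (k + 1) : ℂ) * Complex.exp (Complex.I * ((k + 1 : ℤ) : ℂ) * y)) := by
    intro k
    rw [mul_left_comm, ← Complex.exp_add]
    congr 2
    push_cast; ring
  have hs' := (Equiv.addRight (1 : ℤ)).summable_iff.2 hs
  have ht := (Equiv.addRight (1 : ℤ)).tsum_eq
    (fun k : ℤ => (a k : ℂ) * Complex.exp (Complex.I * k * y))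
  simp only [Equiv.coe_addRight, Function.comp_def] at hs' ht
  unfold Kr sdiff'
  calc _ = ∑' k : ℤ, ((a (k + 1) : ℂ) * Complex.exp (Complex.I * k * y)
        - (a k : ℂ) * Complex.exp (Complex.I * k * y)) := by
        congr 1; ext k; push_cast; ring
    _ = _ := by
      rw [Summable.tsum_sub _ hs, sub_mul, one_mul]
      · congr 1
        rw [tsum_congr e1, tsum_mul_left, ht]
      · rw [summable_congr e1]
        exact hs'.mul_left _

lemma sdiff_supp (a : ℤ → ℝ) (R : ℕ) (ha : ∀ k : ℤ, (R : ℤ) < |k| → a k = 0) :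
    ∀ k : ℤ, ((R + 1 : ℕ) : ℤ) < |k| → sdiff' a k = 0 := by
  intro k hk
  unfold sdiff'
  rw [ha k, ha (k + 1)]
  · simp
  · rw [lt_abs] at *; push_cast at hk; omega
  · rw [lt_abs] at *; push_cast at hk; omega

lemma norm_exp_sub_one (y : ℝ) (hy : |y| ≤ π) :
    2 / π * |y| ≤ ‖Complex.exp (-Complex.I * y) - 1‖ := by
  have h := Complex.norm_exp_I_mul_ofReal_sub_one (-y)
  have e : Complex.I * ((-y : ℝ) : ℂ) = -Complex.I * y := by push_cast; ring
  rw [e] at h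
  rw [h]
  have h2 : |y / 2| ≤ π / 2 := by rw [abs_div, abs_two]; linarith
  have := Real.mul_abs_le_abs_sin h2
  rw [neg_div, Real.sin_neg, mul_neg, norm_neg, norm_mul, Real.norm_eq_abs, Real.norm_eq_abs, abs_two]
  rw [abs_div, abs_two] at this
  linarith

lemma exp_periodic (y : ℝ) (m : ℤ) :
    Complex.exp (-Complex.I * ((y - m * (2 * π) : ℝ) : ℂ)) = Complex.exp (-Complex.I * y) := by
  rw [Complex.exp_eq_exp_iff_exists_int]
  exact ⟨m, by push_cast; ring⟩

lemma w_bound (w : ℝ → ℂ) (M : ℝ) (hw : Function.Periodic w (2 * π)) (hc : ContDiff ℝ 1 w)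
    (hM : ∀ x, ‖deriv w x‖ ≤ M) (x t : ℝ) :
    ‖w t - w x‖ ≤ M * (π / 2) * ‖Complex.exp (-Complex.I * ((x - t : ℝ) : ℂ)) - 1‖ := by
  have hM0 : 0 ≤ M := (norm_nonneg _).trans (hM 0)
  have hpi := Real.pi_pos
  set m : ℤ := round ((x - t) / (2 * π)) with hm
  have h1 : |x - t - m * (2 * π)| ≤ π := by
    have := abs_sub_round ((x - t) / (2 * π))
    rw [← hm] at this
    have e : x - t - m * (2 * π) = ((x - t) / (2 * π) - m) * (2 * π) := by field_simp
    rw [e, abs_mul, abs_of_pos (by positivity : 0 < 2 * π)]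
    nlinarith
  have h2 := norm_exp_sub_one _ h1
  rw [exp_periodic] at h2
  have h3 := Convex.norm_image_sub_le_of_norm_deriv_le (f := w) (s := Set.univ) (C := M)
    (x := x) (y := t + m * (2 * π)) (fun x _ => (hc.differentiable (by simp)) x)
    (fun x _ => hM x) convex_univ trivial trivial
  rw [hw.int_mul m t] at h3
  have e2 : ‖t + m * (2 * π) - x‖ = |x - t - m * (2 * π)| := by
    rw [Real.norm_eq_abs, ← abs_neg]; congr 1; ring
  rw [e2] at h3
  refine h3.trans ?_
  rw [mul_assoc]
  refine mul_le_mul_of_nonneg_left ?_ hM0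
  calc _ = π / 2 * (2 / π * |x - t - m * (2 * π)|) := by field_simp
    _ ≤ _ := by gcongr

/-- weighted kernel -/
def Hk (a : ℤ → ℝ) (y : ℝ) : ℝ := ‖(Complex.exp (-Complex.I * y) - 1) * Kr a y‖

lemma Kr_cont (a : ℤ → ℝ) (R : ℕ) (ha : ∀ k : ℤ, (R : ℤ) < |k| → a k = 0) :
    Continuous (Kr a) := by
  rw [funext (Kr_eq_sum a R ha)]
  fun_prop

lemma Hk_cont (a : ℤ → ℝ) (R : ℕ) (ha : ∀ k : ℤ, (R : ℤ) < |k| → a k = 0) :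
    Continuous (Hk a) := by
  have := Kr_cont a R ha
  unfold Hk; fun_prop

lemma Hk_per (a : ℤ → ℝ) : Function.Periodic (Hk a) (2 * π) := by
  intro y
  unfold Hk Kr
  congr 2
  · congr 1
    rw [Complex.exp_eq_exp_iff_exists_int]
    exact ⟨-1, by push_cast; ring⟩
  · congr 1; ext k; congr 1
    rw [Complex.exp_eq_exp_iff_exists_int]
    exact ⟨k, by push_cast; ring⟩

lemma Hk_int (φ : ℝ → ℝ) (hφsm : ContDiff ℝ (⊤ : ℕ∞) φ)
    (hφsupp : ∀ ξ : ℝ, φ ξ ≠ 0 → 1 / 2 ≤ |ξ| ∧ |ξ| ≤ 2) :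
    ∃ A > 0, ∀ n : ℕ, ∫ y in (0 : ℝ)..(2 * π),
      Hk (fun k => (k : ℝ) * φ ((k : ℝ) / 2 ^ n) ^ 2) y ≤ A := by
  have hpi := Real.pi_pos
  set g : ℝ → ℝ := fun ξ => ξ * φ ξ ^ 2 with hg
  have gsm : ContDiff ℝ (⊤ : ℕ∞) g := by fun_prop
  have gsupp : HasCompactSupport g := by
    apply HasCompactSupport.intro (K := Set.Icc (-2) 2) isCompact_Icc
    intro x hx
    by_contra h
    have : φ x ≠ 0 := by
      intro h0; apply h; simp [hg, h0]
    exact hx (abs_le.1 (hφsupp x this).2)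
  have g1 := contDiff_deriv_top _ gsm
  have g2 := contDiff_deriv_top _ g1
  have g3 := contDiff_deriv_top _ g2
  obtain ⟨B1, hB1, hb1⟩ := bdd_of_compact _ g1.continuous gsupp.deriv
  obtain ⟨B3, hB3, hb3⟩ := bdd_of_compact _ g3.continuous gsupp.deriv.deriv.deriv
  refine ⟨11 * (B1 + π ^ 2 / 4 * B3) * π + 1, by positivity, fun n => ?_⟩
  set N : ℝ := 2 ^ n with hN
  have hN1 : 1 ≤ N := one_le_pow₀ (by norm_num)
  have hN0 : 0 < N := by linarith
  set a : ℤ → ℝ := fun k => (k : ℝ) * φ ((k : ℝ) / N) ^ 2 with ha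
  have hsupp : ∀ k : ℤ, ((2 * 2 ^ n : ℕ) : ℤ) < |k| → a k = 0 := by
    intro k hk
    by_contra h
    have : φ (k / N) ≠ 0 := by
      intro h0; apply h; simp [ha, h0]
    have h2 := (hφsupp _ this).2
    rw [abs_div, abs_of_pos hN0, div_le_iff₀ hN0] at h2
    have hk' : (((2 * 2 ^ n : ℕ) : ℤ) : ℝ) < ((|k| : ℤ) : ℝ) := by exact_mod_cast hk
    push_cast at hk'
    rw [← hN] at hk'
    linarith
  have s1 := sdiff_supp _ _ hsupp
  have s2 := sdiff_supp _ _ s1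
  have s3 := sdiff_supp _ _ s2
  have cst : ∀ f : ℝ → ℝ, sdiff' (fun k : ℤ => N * f ((k : ℝ) / N)) = fun k : ℤ => N * fdiff (1 / N) f (k / N) := by
    intro f; ext k
    simp only [sdiff', fdiff]
    push_cast
    rw [add_div]; ring
  have ea : a = fun k : ℤ => N * g (k / N) := by
    ext k; simp only [ha, hg]; field_simp
  have e1 : sdiff' a = fun k : ℤ => N * fdiff (1 / N) g (k / N) := by rw [ea, cst]
  have e3 : sdiff' (sdiff' (sdiff' a)) =
      fun k : ℤ => N * fdiff (1 / N) (fdiff (1 / N) (fdiff (1 / N) g)) (k / N) := by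
    rw [e1, cst, cst]
  have b1 : ∀ k, |sdiff' a k| ≤ B1 := by
    intro k
    rw [e1]
    have := fdiff_bound g (gsm.differentiable (by simp)) B1 (1 / N) (by positivity) hb1 (k / N)
    simp only [abs_mul, abs_of_pos hN0]
    calc _ ≤ N * (B1 * (1 / N)) := by gcongr
      _ = _ := by field_simp
  have b3 : ∀ k, |sdiff' (sdiff' (sdiff' a)) k| ≤ B3 / N ^ 2 := by
    intro k
    rw [e3]
    have := fdiff3_bound g gsm B3 (1 / N) (by positivity) hb3 (k / N)
    simp only [abs_mul, abs_of_pos hN0]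
    calc _ ≤ N * (B3 * (1 / N) * (1 / N) * (1 / N)) := by gcongr
      _ = _ := by field_simp
  have k1 : ∀ y, Hk a y ≤ 11 * N * B1 := by
    intro y
    have := Kr_bound _ _ s1 B1 b1 y
    rw [Kr_sdiff _ _ hsupp] at this
    refine this.trans ?_
    gcongr
    push_cast
    rw [← hN]; linarith
  have k3 : ∀ y : ℝ, Hk a y * ‖Complex.exp (-Complex.I * y) - 1‖ ^ 2 ≤ 11 * N * (B3 / N ^ 2) := by
    intro y
    have := Kr_bound _ _ s3 _ b3 y
    rw [Kr_sdiff _ _ s2, Kr_sdiff _ _ s1, Kr_sdiff _ _ hsupp] at this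
    calc _ = _ := ?_
      _ ≤ _ := this
      _ ≤ _ := ?_
    · unfold Hk; rw [norm_mul, norm_mul, norm_mul, norm_mul]; ring
    · gcongr
      push_cast
      rw [← hN]; linarith
  have key : ∀ y, |y| ≤ π → Hk a y ≤ 11 * (B1 + π ^ 2 / 4 * B3) * (N * (1 + (N * y) ^ 2)⁻¹) := by
    intro y hy
    have hs := norm_exp_sub_one y hy
    have H0 : 0 ≤ Hk a y := norm_nonneg _
    have hs2 : (2 / π * |y|) ^ 2 ≤ ‖Complex.exp (-Complex.I * y) - 1‖ ^ 2 := by gcongr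
    have h3 : Hk a y * (2 / π * |y|) ^ 2 ≤ 11 * N * (B3 / N ^ 2) :=
      (mul_le_mul_of_nonneg_left hs2 H0).trans (k3 y)
    have h4 : Hk a y * (N * y) ^ 2 ≤ 11 * N * (π ^ 2 / 4 * B3) := by
      calc _ = N ^ 2 * (π ^ 2 / 4) * (Hk a y * (2 / π * |y|) ^ 2) := by
            rw [mul_pow (2 / π), sq_abs]; field_simp; ring
        _ ≤ N ^ 2 * (π ^ 2 / 4) * (11 * N * (B3 / N ^ 2)) := by gcongr
        _ = _ := by field_simp
    have h5 := k1 y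
    rw [← mul_assoc, ← div_eq_mul_inv, le_div_iff₀ (by positivity)]
    linarith
  have hper := (Hk_per a).intervalIntegral_add_eq 0 (-π)
  rw [zero_add, show -π + 2 * π = π by ring] at hper
  rw [hper]
  have hcont : Continuous fun y : ℝ => 11 * (B1 + π ^ 2 / 4 * B3) * (N * (1 + (N * y) ^ 2)⁻¹) := by
    have : ∀ y : ℝ, 1 + (N * y) ^ 2 ≠ 0 := fun y => by positivity
    fun_prop (disch := assumption)
  have hmono := intervalIntegral.integral_mono_on (a := -π) (b := π) (μ := volume) (by linarith)
    ((Hk_cont a _ hsupp).intervalIntegrable _ _) (hcont.intervalIntegrable _ _)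
    (fun y hy => key y (abs_le.2 hy))
  refine hmono.trans ?_
  rw [intervalIntegral.integral_const_mul, intervalIntegral.integral_const_mul,
    ← smul_eq_mul N, intervalIntegral.smul_integral_comp_mul_left (fun x => (1 + x ^ 2)⁻¹) N,
    integral_inv_one_add_sq]
  have t1 := Real.arctan_lt_pi_div_two (N * π)
  have t2 := Real.neg_pi_div_two_lt_arctan (N * -π)
  have t3 : arctan (N * π) - arctan (N * -π) ≤ π := by linarith
  have := mul_le_mul_of_nonneg_left t3 (show 0 ≤ 11 * (B1 + π ^ 2 / 4 * B3) by positivity)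
  linarith

lemma cs_int (H f : ℝ → ℝ) (hH : Continuous H) (hf : Continuous f) (h0 : ∀ t, 0 ≤ H t)
    (A : ℝ) (hA : 0 < A) (hHA : ∫ t in (0 : ℝ)..(2 * π), H t ≤ A) :
    (∫ t in (0 : ℝ)..(2 * π), H t * f t) ^ 2 ≤ A * ∫ t in (0 : ℝ)..(2 * π), H t * f t ^ 2 := by
  have hpi := Real.pi_pos
  set J := ∫ t in (0 : ℝ)..(2 * π), H t * f t with hJ
  set c := J / A with hc
  have h1 : 0 ≤ ∫ t in (0 : ℝ)..(2 * π), H t * (f t - c) ^ 2 :=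
    intervalIntegral.integral_nonneg (by positivity) fun t _ => mul_nonneg (h0 t) (sq_nonneg _)
  have h2 : ∫ t in (0 : ℝ)..(2 * π), H t * (f t - c) ^ 2
      = (∫ t in (0 : ℝ)..(2 * π), H t * f t ^ 2) - 2 * c * J
        + c ^ 2 * ∫ t in (0 : ℝ)..(2 * π), H t := by
    rw [hJ, ← intervalIntegral.integral_const_mul, ← intervalIntegral.integral_const_mul,
      ← intervalIntegral.integral_sub, ← intervalIntegral.integral_add]
    · congr 1; ext t; ring
    all_goals exact Continuous.intervalIntegrable (by fun_prop) _ _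
  rw [h2] at h1
  have h3 : c ^ 2 * (∫ t in (0 : ℝ)..(2 * π), H t) ≤ c ^ 2 * A := by gcongr
  have h4 : c * A = J := by rw [hc]; field_simp
  have h5 : 0 ≤ (∫ t in (0 : ℝ)..(2 * π), H t * f t ^ 2) - c * J := by
    have : c ^ 2 * A = c * J := by rw [← h4]; ring
    linarith
  have := mul_nonneg hA.le h5
  have e : A * (c * J) = J ^ 2 := by rw [← mul_assoc, mul_comm A, h4]; ring
  linarith

lemma dPNsq_eq (m : ℤ → ℝ) (R : ℕ) (hm : ∀ k : ℤ, (R : ℤ) < |k| → (k : ℝ) * m k ^ 2 = 0)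
    (u : ℝ → ℂ) (hu : Continuous u) (x : ℝ) :
    dPNsq m u x = (1 / (2 * π)) * ∫ t in (0 : ℝ)..(2 * π),
      Complex.I * Kr (fun k => (k : ℝ) * m k ^ 2) (x - t) * u t := by
  have e : ∀ t : ℝ, Complex.I * Kr (fun k => (k : ℝ) * m k ^ 2) (x - t) * u t =
      ∑ k ∈ Finset.Icc (-(R : ℤ)) R, (Complex.I * k * (m k : ℂ) ^ 2 *
        Complex.exp (Complex.I * k * x)) * (u t * Complex.exp (-Complex.I * k * t)) := by
    intro t
    rw [Kr_eq_sum _ R hm, Finset.mul_sum, Finset.sum_mul]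
    refine Finset.sum_congr rfl fun k _ => ?_
    have : Complex.exp (Complex.I * k * ((x - t : ℝ) : ℂ)) =
        Complex.exp (Complex.I * k * x) * Complex.exp (-Complex.I * k * t) := by
      rw [← Complex.exp_add]; congr 1; push_cast; ring
    rw [this]; push_cast; ring
  rw [intervalIntegral.integral_congr (fun t _ => e t), intervalIntegral.integral_finsetSum]
  · unfold dPNsq
    rw [tsum_eq_sum (s := Finset.Icc (-(R : ℤ)) R), Finset.mul_sum]
    · refine Finset.sum_congr rfl fun k _ => ?_
      rw [intervalIntegral.integral_const_mul]
      unfold fc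
      ring
    · intro k hk
      have := hm k (by
        by_contra! h
        exact hk (Finset.mem_Icc.2 (abs_le.1 h)))
      have h' : (k : ℂ) * (m k : ℂ) ^ 2 = 0 := by exact_mod_cast this
      rw [mul_assoc Complex.I, h']; simp
  · intro k _
    exact Continuous.intervalIntegrable (by fun_prop) _ _

lemma main_bound (m : ℤ → ℝ) (R : ℕ) (hm : ∀ k : ℤ, (R : ℤ) < |k| → (k : ℝ) * m k ^ 2 = 0)
    (A : ℝ) (hA : 0 < A)
    (hHA : ∫ y in (0 : ℝ)..(2 * π), Hk (fun k => (k : ℝ) * m k ^ 2) y ≤ A)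
    (w v : ℝ → ℂ) (M : ℝ) (hw : Function.Periodic w (2 * π)) (hv : Continuous v)
    (hc : ContDiff ℝ 1 w) (hM : ∀ x, ‖deriv w x‖ ≤ M) :
    ∫ x in (0 : ℝ)..(2 * π), ‖dPNsq m (fun t => w t * v t) x - w x * dPNsq m v x‖ ^ 2
      ≤ (A * M) ^ 2 * ∫ x in (0 : ℝ)..(2 * π), ‖v x‖ ^ 2 := by
  have hpi := Real.pi_pos
  have hM0 : 0 ≤ M := (norm_nonneg _).trans (hM 0)
  have hwc := hc.continuous
  set a : ℤ → ℝ := fun k => (k : ℝ) * m k ^ 2 with ha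
  have hKc := Kr_cont a R hm
  have hHc := Hk_cont a R hm
  have hH0 : ∀ y, 0 ≤ Hk a y := fun y => norm_nonneg _
  have hHper := Hk_per a
  have shift1 : ∀ t, ∫ x in (0 : ℝ)..(2 * π), Hk a (x - t) = ∫ y in (0 : ℝ)..(2 * π), Hk a y := by
    intro t
    rw [intervalIntegral.integral_comp_sub_right (Hk a) t]
    have := hHper.intervalIntegral_add_eq (0 - t) 0
    rw [zero_add] at this
    rw [← this]; congr 1; ring
  have shift2 : ∀ x, ∫ t in (0 : ℝ)..(2 * π), Hk a (x - t) = ∫ y in (0 : ℝ)..(2 * π), Hk a y := by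
    intro x
    rw [intervalIntegral.integral_comp_sub_left (Hk a) x]
    have := hHper.intervalIntegral_add_eq (x - 2 * π) 0
    rw [zero_add] at this
    rw [← this]; congr 1; ring
  have ecomm : ∀ x, dPNsq m (fun t => w t * v t) x - w x * dPNsq m v x =
      (1 / (2 * π)) * ∫ t in (0 : ℝ)..(2 * π),
        Complex.I * Kr a (x - t) * (w t - w x) * v t := by
    intro x
    rw [dPNsq_eq m R hm _ (by fun_prop), dPNsq_eq m R hm _ hv, mul_left_comm, ← mul_sub,
      ← intervalIntegral.integral_const_mul, ← intervalIntegral.integral_sub]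
    · congr 2; ext t; ring
    all_goals exact Continuous.intervalIntegrable (by fun_prop) _ _
  have pt : ∀ x, ‖dPNsq m (fun t => w t * v t) x - w x * dPNsq m v x‖ ≤
      M * ∫ t in (0 : ℝ)..(2 * π), Hk a (x - t) * ‖v t‖ := by
    intro x
    have I0 : 0 ≤ ∫ t in (0 : ℝ)..(2 * π), Hk a (x - t) * ‖v t‖ :=
      intervalIntegral.integral_nonneg (by positivity)
        fun t _ => mul_nonneg (hH0 _) (norm_nonneg _)
    rw [ecomm, norm_mul]
    have hn : ‖(1 / (2 * π) : ℂ)‖ = 1 / (2 * π) := by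
      simp [abs_of_pos hpi]
    rw [hn]
    have h1 : ‖∫ t in (0 : ℝ)..(2 * π), Complex.I * Kr a (x - t) * (w t - w x) * v t‖ ≤
        ∫ t in (0 : ℝ)..(2 * π), M * (π / 2) * (Hk a (x - t) * ‖v t‖) := by
      refine intervalIntegral.norm_integral_le_of_norm_le (by positivity) ?_ ?_
      · refine Filter.Eventually.of_forall fun t _ => ?_
        rw [norm_mul, norm_mul, norm_mul, Complex.norm_I, one_mul]
        have := w_bound w M hw hc hM x t
        calc _ ≤ ‖Kr a (x - t)‖ *
              (M * (π / 2) * ‖Complex.exp (-Complex.I * ((x - t : ℝ) : ℂ)) - 1‖) * ‖v t‖ := by gcongr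
          _ = _ := by unfold Hk; rw [norm_mul]; ring
      · exact Continuous.intervalIntegrable (by fun_prop) _ _
    rw [intervalIntegral.integral_const_mul] at h1
    calc _ ≤ 1 / (2 * π) * (M * (π / 2) * ∫ t in (0 : ℝ)..(2 * π), Hk a (x - t) * ‖v t‖) := by gcongr
      _ = 1 / 4 * (M * ∫ t in (0 : ℝ)..(2 * π), Hk a (x - t) * ‖v t‖) := by field_simp; ring
      _ ≤ _ := by nlinarith [mul_nonneg hM0 I0]
  have pt2 : ∀ x, ‖dPNsq m (fun t => w t * v t) x - w x * dPNsq m v x‖ ^ 2 ≤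
      M ^ 2 * A * ∫ t in (0 : ℝ)..(2 * π), Hk a (x - t) * ‖v t‖ ^ 2 := by
    intro x
    have := cs_int (fun t => Hk a (x - t)) (fun t => ‖v t‖) (by fun_prop) (by fun_prop)
      (fun t => hH0 _) A hA (by rw [shift2]; exact hHA)
    calc _ ≤ (M * ∫ t in (0 : ℝ)..(2 * π), Hk a (x - t) * ‖v t‖) ^ 2 := by gcongr; exact pt x
      _ = M ^ 2 * (∫ t in (0 : ℝ)..(2 * π), Hk a (x - t) * ‖v t‖) ^ 2 := by ring
      _ ≤ M ^ 2 * (A * ∫ t in (0 : ℝ)..(2 * π), Hk a (x - t) * ‖v t‖ ^ 2) := by gcongr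
      _ = _ := by ring
  have c1 : Continuous fun x => ‖dPNsq m (fun t => w t * v t) x - w x * dPNsq m v x‖ ^ 2 := by
    simp only [ecomm]
    have : Continuous fun x => ∫ t in (0 : ℝ)..(2 * π),
        Complex.I * Kr a (x - t) * (w t - w x) * v t :=
      intervalIntegral.continuous_parametric_intervalIntegral_of_continuous'
        (by unfold Function.uncurry; fun_prop) _ _
    fun_prop
  have c2 : Continuous fun x => ∫ t in (0 : ℝ)..(2 * π), Hk a (x - t) * ‖v t‖ ^ 2 :=
    intervalIntegral.continuous_parametric_intervalIntegral_of_continuous'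
        (by unfold Function.uncurry; fun_prop) _ _
  have h1 := intervalIntegral.integral_mono_on (a := 0) (b := 2 * π) (μ := volume) (by positivity)
    (c1.intervalIntegrable _ _) ((c2.const_mul (M ^ 2 * A)).intervalIntegrable _ _)
    (fun x _ => pt2 x)
  refine h1.trans ?_
  rw [intervalIntegral.integral_const_mul]
  have swap : ∫ x in (0 : ℝ)..(2 * π), ∫ t in (0 : ℝ)..(2 * π), Hk a (x - t) * ‖v t‖ ^ 2 =
      ∫ t in (0 : ℝ)..(2 * π), ∫ x in (0 : ℝ)..(2 * π), Hk a (x - t) * ‖v t‖ ^ 2 := by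
    refine MeasureTheory.intervalIntegral_intervalIntegral_swap ?_
    have cc : Continuous (Function.uncurry fun x t : ℝ => Hk a (x - t) * ‖v t‖ ^ 2) := by
      unfold Function.uncurry; fun_prop
    exact (cc.continuousOn.integrableOn_compact (isCompact_uIcc.prod isCompact_uIcc)).mono_set
      (Set.prod_mono Set.uIoc_subset_uIcc Set.uIoc_subset_uIcc)
  rw [swap]
  simp_rw [intervalIntegral.integral_mul_const, shift1]
  rw [intervalIntegral.integral_const_mul]
  have V0 : 0 ≤ ∫ t in (0 : ℝ)..(2 * π), ‖v t‖ ^ 2 :=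
    intervalIntegral.integral_nonneg (by positivity) fun t _ => by positivity
  calc _ ≤ M ^ 2 * A * (A * ∫ t in (0 : ℝ)..(2 * π), ‖v t‖ ^ 2) := by gcongr
    _ = _ := by ring

/-- commutator estimate
`‖[∂ₓP_N², w]v‖_{L²} ≤ C ‖∂ₓw‖_{L^∞} ‖v‖_{L²}`, uniformly in the dyadic number `N = 2^n`. -/
theorem commutator_estimate
    (φ : ℝ → ℝ) (hφsm : ContDiff ℝ (⊤ : ℕ∞) φ)
    (hφsupp : ∀ ξ : ℝ, φ ξ ≠ 0 → 1 / 2 ≤ |ξ| ∧ |ξ| ≤ 2) :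
    ∃ C > 0, ∀ (n : ℕ) (w v : ℝ → ℂ) (M : ℝ),
      Function.Periodic w (2 * π) → Function.Periodic v (2 * π) →
      Continuous v → ContDiff ℝ 1 w →
      (∀ x : ℝ, ‖deriv w x‖ ≤ M) →
      (∫ x in (0 : ℝ)..(2 * π),
          ‖dPNsq (fun k => φ ((k : ℝ) / 2 ^ n)) (fun t => w t * v t) x
            - w x * dPNsq (fun k => φ ((k : ℝ) / 2 ^ n)) v x‖ ^ 2) ^ (1 / 2 : ℝ)
        ≤ C * M * (∫ x in (0 : ℝ)..(2 * π), ‖v x‖ ^ 2) ^ (1 / 2 : ℝ) := by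
  obtain ⟨A, hA, hb⟩ := Hk_int φ hφsm hφsupp
  refine ⟨A, hA, fun n w v M hw _ hv hc hM => ?_⟩
  have hM0 : 0 ≤ M := (norm_nonneg _).trans (hM 0)
  have hN0 : (0 : ℝ) < 2 ^ n := by positivity
  have hsupp : ∀ k : ℤ, ((2 * 2 ^ n : ℕ) : ℤ) < |k| → (k : ℝ) * φ ((k : ℝ) / 2 ^ n) ^ 2 = 0 := by
    intro k hk
    by_contra h
    have : φ (k / 2 ^ n) ≠ 0 := by
      intro h0; apply h; simp [h0]
    have h2 := (hφsupp _ this).2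
    rw [abs_div, abs_of_pos hN0, div_le_iff₀ hN0] at h2
    have hk' : (((2 * 2 ^ n : ℕ) : ℤ) : ℝ) < ((|k| : ℤ) : ℝ) := by exact_mod_cast hk
    push_cast at hk'
    linarith
  have h := main_bound (fun k => φ ((k : ℝ) / 2 ^ n)) (2 * 2 ^ n) hsupp A hA (hb n) w v M hw hv hc hM
  rw [← Real.sqrt_eq_rpow, ← Real.sqrt_eq_rpow]
  refine (Real.sqrt_le_sqrt h).trans ?_
  rw [Real.sqrt_mul (sq_nonneg _), Real.sqrt_sq (by positivity)]
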